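/- Let M be a locally compact sober MT-algebra and F a Scott-open filter of M. Then the upward closure of {η(a) | a ∈ F} in the powerset of at(M) is a Scott-open filter of the MT-algebra (P(at(M)), int), where int is the interior operator of the topology of at(M). -/

import Mathlib

/-- An MT-algebra: a complete Boolean algebra with an interior operator. -/
structure MTAlg (M : Type*) [CompleteBooleanAlgebra M] where
  box : M → M
  box_top : box ⊤ = ⊤
  box_inf : ∀ a b : M, box (a ⊓ b) = box a ⊓ box b
  box_le : ∀ a : M, box a ≤ a
  box_idem : ∀ a : M, box a ≤ box (box a)

namespace MTAlg

variable {M : Type*} [CompleteBooleanAlgebra M] (T : MTAlg M)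

/-- The closure (dual) operator. -/
def dia (a : M) : M := (T.box aᶜ)ᶜ

/-- Open elements. -/
def IsOpenElem (a : M) : Prop := T.box a = a

/-- Closed elements. -/
def IsClosedElem (a : M) : Prop := T.dia a = a

/-- Saturated elements: meets of open elements. -/
def IsSaturatedElem (a : M) : Prop :=
  ∃ S : Set M, (∀ s ∈ S, T.IsOpenElem s) ∧ a = sInf S

/-- Weakly locally closed elements: meets of a saturated and a closed element. -/
def IsWLC (a : M) : Prop :=
  ∃ s c : M, T.IsSaturatedElem s ∧ T.IsClosedElem c ∧ a = s ⊓ c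

/-- T0-algebras: every element is a join of weakly locally closed elements. -/
def IsT0 : Prop :=
  ∀ a : M, ∃ S : Set M, (∀ b ∈ S, T.IsWLC b) ∧ a = sSup S

/-- T1-algebras: every element is a join of closed elements. -/
def IsT1 : Prop :=
  ∀ a : M, ∃ S : Set M, (∀ b ∈ S, T.IsClosedElem b) ∧ a = sSup S

/-- Join-irreducible elements of the lattice of closed elements. -/
def JoinIrredClosed (p : M) : Prop :=
  T.IsClosedElem p ∧ p ≠ ⊥ ∧
    ∀ a b : M, T.IsClosedElem a → T.IsClosedElem b → p = a ⊔ b → p = a ∨ p = b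

/-- Sober MT-algebras. -/
def Sober : Prop :=
  T.IsT0 ∧ ∀ p : M, T.JoinIrredClosed p → ∃ x : M, IsAtom x ∧ p = T.dia x

/-- Filters of the underlying lattice. -/
def IsFilter (F : Set M) : Prop :=
  ⊤ ∈ F ∧ (∀ a b : M, a ∈ F → a ≤ b → b ∈ F) ∧ (∀ a b : M, a ∈ F → b ∈ F → a ⊓ b ∈ F)

/-- Open filters. -/
def IsOpenFilter (F : Set M) : Prop :=
  IsFilter F ∧ ∀ a ∈ F, T.box a ∈ F

/-- Scott-open filters. -/
def IsScottOpenFilter (F : Set M) : Prop :=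
  T.IsOpenFilter F ∧
    ∀ S : Set M, (∀ s ∈ S, T.IsOpenElem s) → S.Nonempty → DirectedOn (· ≤ ·) S →
      sSup S ∈ F → ∃ s ∈ S, s ∈ F

/-- Compact elements. -/
def IsCompactElem (a : M) : Prop :=
  ∀ S : Set M, (∀ s ∈ S, T.IsOpenElem s) → a ≤ sSup S →
    ∃ t ⊆ S, t.Finite ∧ a ≤ sSup t

/-- The relation `a ◁ b`: there is a compact element between `a` and `b`. -/
def Triangle (a b : M) : Prop := ∃ k : M, T.IsCompactElem k ∧ a ≤ k ∧ k ≤ b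

/-- Locally compact MT-algebras. -/
def LocallyCompact : Prop :=
  ∀ u : M, T.IsOpenElem u → u = sSup {v : M | T.IsOpenElem v ∧ T.Triangle v u}

/-- The way-below relation in the frame of open elements. -/
def WayBelowOpen (a b : M) : Prop :=
  ∀ S : Set M, (∀ s ∈ S, T.IsOpenElem s) → b ≤ sSup S →
    ∃ t ⊆ S, t.Finite ∧ a ≤ sSup t

/-- Elements approximated from above by regular closed elements. -/
def GC (a : M) : Prop :=
  a = sInf {b : M | ∃ c : M, a ≤ T.box c ∧ b = T.dia (T.box c)}

/-- Hausdorff MT-algebras. -/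
def IsHausdorff : Prop :=
  ∀ a : M, ∃ S : Set M, (∀ b ∈ S, T.GC b) ∧ a = sSup S

/-- Regular MT-algebras. -/
def IsRegular : Prop :=
  T.IsT1 ∧ ∀ a : M, T.IsOpenElem a →
    a = sSup {b : M | T.IsOpenElem b ∧ T.dia b ≤ a}

end MTAlg

/-- The atom space of a complete Boolean algebra. -/
abbrev AtomSpace (M : Type*) [CompleteBooleanAlgebra M] : Type _ := {x : M // IsAtom x}

/-- The set of atoms below an element. -/
def eta {M : Type*} [CompleteBooleanAlgebra M] (a : M) : Set (AtomSpace M) :=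
  {x : AtomSpace M | x.1 ≤ a}

namespace MTAlg

variable {M : Type*} [CompleteBooleanAlgebra M] (T : MTAlg M)

/-- The topology on the atom space, generated by the images of open elements. -/
def atTop : TopologicalSpace (AtomSpace M) :=
  TopologicalSpace.generateFrom {U : Set (AtomSpace M) | ∃ u : M, T.IsOpenElem u ∧ U = eta u}

end MTAlg

/-- The MT-algebra `(P(X), int)` of a topological space. -/
def powMT (X : Type*) (t : TopologicalSpace X) : MTAlg (Set X) :=
  letI := t
  { box := interior
    box_top := interior_univ
    box_inf := fun a b => interior_inter
    box_le := fun a => interior_subset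
    box_idem := fun a => le_of_eq (interior_interior (s := a)).symm }

namespace MTAlg

variable {M : Type*} [CompleteBooleanAlgebra M] {T : MTAlg M}

theorem box_mono {a b : M} (h : a ≤ b) : T.box a ≤ T.box b := by
  have := T.box_inf a b
  rw [inf_eq_left.2 h] at this
  rw [this]
  exact inf_le_right

theorem isOpenElem_box (a : M) : T.IsOpenElem (T.box a) :=
  le_antisymm (T.box_le _) (T.box_idem a)

theorem IsOpenElem.sSup {S : Set M} (hS : ∀ s ∈ S, T.IsOpenElem s) :
    T.IsOpenElem (sSup S) := by
  refine le_antisymm (T.box_le _) (sSup_le fun s hs => ?_)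
  exact (hS s hs).ge.trans (box_mono (le_sSup hs))

theorem IsOpenElem.inf {a b : M} (ha : T.IsOpenElem a) (hb : T.IsOpenElem b) :
    T.IsOpenElem (a ⊓ b) := by
  unfold IsOpenElem at *
  rw [T.box_inf, ha, hb]

theorem IsOpenElem.isClosedElem_compl {a : M} (ha : T.IsOpenElem a) : T.IsClosedElem aᶜ := by
  unfold IsOpenElem IsClosedElem dia at *
  rw [compl_compl, ha]

theorem IsClosedElem.isOpenElem_compl {a : M} (ha : T.IsClosedElem a) : T.IsOpenElem aᶜ := by
  unfold IsOpenElem IsClosedElem dia at *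
  rw [← compl_compl (T.box aᶜ), ha]

theorem le_dia (a : M) : a ≤ T.dia a := le_compl_comm.1 (T.box_le aᶜ)

theorem dia_mono {a b : M} (h : a ≤ b) : T.dia a ≤ T.dia b :=
  compl_le_compl (box_mono (compl_le_compl h))

/-- An open element that is maximal among those not above a compact element is
meet-irreducible, so its complement is join-irreducible among closed elements. -/
theorem joinIrredClosed_compl_of_maximal {k p : M}
    (hp : Maximal (fun q => T.IsOpenElem q ∧ ¬ k ≤ q) p) : T.JoinIrredClosed pᶜ := by
  refine ⟨hp.prop.1.isClosedElem_compl, fun h => ?_, fun a b ha hb hab => ?_⟩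
  · exact hp.prop.2 (le_top.trans_eq (compl_eq_bot.1 h).symm)
  · have hpab : p = aᶜ ⊓ bᶜ := by rw [← compl_sup, ← hab, compl_compl]
    have key : ∀ c : M, T.IsClosedElem c → p ≤ cᶜ → pᶜ ≠ c → k ≤ cᶜ := by
      intro c hc hpc hne
      by_contra hk
      exact hne (compl_eq_comm.1 (hp.eq_of_le ⟨hc.isOpenElem_compl, hk⟩ hpc).symm)
    by_contra! hne
    refine hp.prop.2 (hpab ▸ le_inf ?_ ?_)
    · exact key a ha (hpab.trans_le inf_le_left) hne.1
    · exact key b hb (hpab.trans_le inf_le_right) hne.2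

/-- A compact element not below an open element `v` is not below some maximal such open
element above `v`. -/
theorem IsCompactElem.exists_maximal {k v : M} (hk : T.IsCompactElem k)
    (hv : T.IsOpenElem v) (hkv : ¬ k ≤ v) :
    ∃ p, v ≤ p ∧ Maximal (fun q => T.IsOpenElem q ∧ ¬ k ≤ q) p := by
  refine zorn_le_nonempty₀ {q | T.IsOpenElem q ∧ ¬ k ≤ q} (fun c hc hchain y hy => ?_) v ⟨hv, hkv⟩
  refine ⟨sSup c, ⟨IsOpenElem.sSup fun s hs => (hc hs).1, fun hle => ?_⟩, fun z hz => le_sSup hz⟩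
  obtain ⟨t, htc, htfin, hkt⟩ := hk c (fun s hs => (hc hs).1) hle
  lift t to Finset M using htfin
  obtain ⟨m, hm, htm⟩ := Finset.sup_le_of_le_directed c ⟨y, hy⟩ hchain.directedOn t
    fun x hx => ⟨x, htc hx, le_rfl⟩
  exact (hc hm).2 (hkt.trans (t.sup_id_eq_sSup.ge.trans htm))

/-- In a locally compact sober MT-algebra, atoms separate open elements. -/
theorem IsOpenElem.le_of_eta_subset (hsob : T.Sober) (hlc : T.LocallyCompact) {u v : M}
    (hu : T.IsOpenElem u) (hv : T.IsOpenElem v) (h : eta u ⊆ eta v) : u ≤ v := by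
  rw [hlc u hu]
  refine sSup_le fun w ⟨_, k, hk, hwk, hku⟩ => hwk.trans ?_
  by_contra hkv
  obtain ⟨p, hvp, hp⟩ := hk.exists_maximal hv hkv
  obtain ⟨x, hx, hpx⟩ := hsob.2 _ (joinIrredClosed_compl_of_maximal hp)
  have hxp : x ≤ pᶜ := hpx ▸ le_dia x
  have hxu : x ≤ u := by
    by_contra hxu
    have hxu' : x ≤ uᶜ := (hx.not_le_iff_disjoint.1 hxu).le_compl_right
    have hup : pᶜ ≤ uᶜ := by
      rw [hpx, ← show T.dia uᶜ = uᶜ from hu.isClosedElem_compl]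
      exact dia_mono hxu'
    exact hp.prop.2 (hku.trans (compl_le_compl_iff_le.1 hup))
  have hxv : x ≤ v := @h ⟨x, hx⟩ hxu
  exact hx.1 (le_bot_iff.1 ((le_inf (hxv.trans hvp) hxp).trans_eq (inf_compl_self p)))

end MTAlg

section eta

variable {M : Type*} [CompleteBooleanAlgebra M]

theorem eta_mono {a b : M} (h : a ≤ b) : eta a ⊆ eta b := fun _ hx => le_trans hx h

theorem eta_inf (a b : M) : eta (a ⊓ b) = eta a ∩ eta b := by
  ext x
  exact le_inf_iff

theorem eta_top : eta (⊤ : M) = Set.univ := Set.eq_univ_of_forall fun _ => le_top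

theorem eta_sSup (S : Set M) : eta (sSup S) = ⋃ s ∈ S, eta s := by
  ext x
  simp only [Set.mem_iUnion, exists_prop]
  refine ⟨fun hx => ?_, fun ⟨s, hs, hx⟩ => le_trans hx (le_sSup hs)⟩
  by_contra! hne
  have hdisj : Disjoint x.1 (sSup S) :=
    disjoint_sSup_iff.2 fun s hs => x.2.not_le_iff_disjoint.1 (hne s hs)
  exact x.2.1 (hdisj.eq_bot_of_le hx)

variable {T : MTAlg M}

theorem MTAlg.isOpen_atTop_iff {U : Set (AtomSpace M)} :
    @IsOpen _ T.atTop U ↔ ∃ u : M, T.IsOpenElem u ∧ eta u = U := by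
  refine ⟨fun hU => ?_, fun ⟨u, hu, h⟩ => .basic _ ⟨u, hu, h.symm⟩⟩
  induction hU with
  | basic _ h => obtain ⟨u, hu, rfl⟩ := h; exact ⟨u, hu, rfl⟩
  | univ => exact ⟨⊤, T.box_top, eta_top⟩
  | inter _ _ _ _ h₁ h₂ =>
    obtain ⟨u, hu, rfl⟩ := h₁
    obtain ⟨v, hv, rfl⟩ := h₂
    exact ⟨u ⊓ v, hu.inf hv, eta_inf u v⟩
  | sUnion S _ ih =>
    refine ⟨sSup {u | T.IsOpenElem u ∧ eta u ∈ S}, .sSup fun _ h => h.1, ?_⟩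
    rw [eta_sSup]
    ext x
    simp only [Set.mem_iUnion, Set.mem_sUnion, exists_prop]
    constructor
    · rintro ⟨u, ⟨_, hu⟩, hx⟩
      exact ⟨_, hu, hx⟩
    · rintro ⟨s, hs, hx⟩
      obtain ⟨u, hu, rfl⟩ := ih s hs
      exact ⟨u, ⟨hu, hs⟩, hx⟩

end eta

/-- The upward closure of the `η`-image of a Scott-open filter of a locally compact
sober MT-algebra is a Scott-open filter of the powerset MT-algebra of the atom space. -/
theorem upEta_scottOpenFilter {M : Type*} [CompleteBooleanAlgebra M] (T : MTAlg M)
    (hsob : T.Sober) (hlc : T.LocallyCompact)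
    (F : Set M) (hF : T.IsScottOpenFilter F) :
    (powMT (AtomSpace M) T.atTop).IsScottOpenFilter
      {A : Set (AtomSpace M) | ∃ a ∈ F, eta a ⊆ A} := by
  obtain ⟨⟨⟨htop, hup, hinf⟩, hbox⟩, hscott⟩ := hF
  refine ⟨⟨⟨⟨⊤, htop, Set.subset_univ _⟩, ?_, ?_⟩, ?_⟩, ?_⟩
  · rintro A B ⟨a, ha, haA⟩ hAB
    exact ⟨a, ha, haA.trans hAB⟩
  · rintro A B ⟨a, ha, haA⟩ ⟨b, hb, hbB⟩
    exact ⟨a ⊓ b, hinf a b ha hb, eta_inf a b ▸ Set.inter_subset_inter haA hbB⟩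
  · rintro A ⟨a, ha, haA⟩
    let := T.atTop
    exact ⟨T.box a, hbox a ha, interior_maximal ((eta_mono (T.box_le a)).trans haA)
      (MTAlg.isOpen_atTop_iff.2 ⟨_, MTAlg.isOpenElem_box a, rfl⟩)⟩
  · rintro S hS ⟨s₀, hs₀⟩ hdir ⟨a, ha, haS⟩
    have hopen : ∀ s ∈ S, ∃ u, T.IsOpenElem u ∧ eta u = s := fun s hs => by
      let := T.atTop
      exact MTAlg.isOpen_atTop_iff.1 (interior_eq_iff_isOpen.1 (hS s hs))
    have hle : T.box a ≤ sSup {u | T.IsOpenElem u ∧ eta u ∈ S} := by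
      refine (MTAlg.isOpenElem_box a).le_of_eta_subset hsob hlc (.sSup fun _ h => h.1) ?_
      intro x hx
      obtain ⟨s, hs, hxs⟩ := haS (eta_mono (T.box_le a) hx)
      obtain ⟨u, hu, rfl⟩ := hopen s hs
      exact le_trans hxs (le_sSup ⟨hu, hs⟩)
    obtain ⟨u, ⟨_, huS⟩, huF⟩ := hscott {u | T.IsOpenElem u ∧ eta u ∈ S} (fun _ h => h.1)
      (by
        obtain ⟨u, hu, rfl⟩ := hopen s₀ hs₀
        exact ⟨u, hu, hs₀⟩)
      (by
        rintro u ⟨hu, huS⟩ v ⟨hv, hvS⟩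
        obtain ⟨s, hs, hus, hvs⟩ := hdir _ huS _ hvS
        obtain ⟨w, hw, rfl⟩ := hopen s hs
        exact ⟨w, ⟨hw, hs⟩, hu.le_of_eta_subset hsob hlc hw hus,
          hv.le_of_eta_subset hsob hlc hw hvs⟩)
      (hup _ _ (hbox a ha) hle)
    exact ⟨eta u, huS, u, huF, subset_rfl⟩
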